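/- Let 𝓞 be the ring of integers of a number field and let m, n be positive integers. Then the normal closure in Γ = SL(2,𝓞) of the set Γ((mn)𝓞) ∪ {T_{mx} : x ∈ 𝓞} equals Γ(m𝓞). -/

import Mathlib

open NumberField Matrix

variable (K : Type*) [Field K] [NumberField K]

/-- The elementary matrix `T_x = [[1, x], [0, 1]]` in `SL(2, 𝓞)`. -/
def T (x : 𝓞 K) : Matrix.SpecialLinearGroup (Fin 2) (𝓞 K) :=
  ⟨!![1, x; 0, 1], by simp [Matrix.det_fin_two_of]⟩

/-- The reduction homomorphism `SL(2, 𝓞) → SL(2, 𝓞/π)`. -/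
def red (π : Ideal (𝓞 K)) :
    Matrix.SpecialLinearGroup (Fin 2) (𝓞 K) →*
      Matrix.SpecialLinearGroup (Fin 2) ((𝓞 K) ⧸ π) :=
  Matrix.SpecialLinearGroup.map (Ideal.Quotient.mk π)

/-- The principal congruence subgroup `Γ(π)`, the kernel of reduction mod `π`. -/
def Gamma (π : Ideal (𝓞 K)) : Subgroup (Matrix.SpecialLinearGroup (Fin 2) (𝓞 K)) :=
  MonoidHom.ker (red K π)

set_option linter.unusedSectionVars false

/-- An Artinian commutative ring has stable range one. -/
theorem IsCoprime.exists_isUnit_add_mul {R : Type*} [CommRing R] [IsArtinianRing R] {a b : R}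
    (h : IsCoprime a b) : ∃ x, IsUnit (a + b * x) := by
  obtain ⟨n, y, hy⟩ := IsArtinian.exists_pow_succ_smul_dvd a (1 : R)
  simp only [smul_eq_mul, mul_one, Nat.succ_eq_add_one] at hy
  refine ⟨1 - a * y, ?_⟩
  by_contra hu
  obtain ⟨p, hp, hmem⟩ := exists_max_ideal_of_mem_nonunits hu
  have hprime := hp.isPrime
  have hone : (1 : R) ∉ p := fun h1 => hprime.ne_top ((Ideal.eq_top_iff_one p).2 h1)
  obtain ⟨u, v, huv⟩ := h
  by_cases ha : a ∈ p
  · have hb : b * (1 - a * y) ∈ p := (p.add_mem_iff_right ha).1 hmem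
    rcases hprime.mem_or_mem hb with hb | hx
    · exact hone (huv ▸ p.add_mem (p.mul_mem_left u ha) (p.mul_mem_left v hb))
    · exact hone ((p.sub_mem_iff_left (p.mul_mem_right y ha)).1 hx)
  · have hz : a ^ n * (1 - a * y) ∈ p := by
      have : a ^ n * (1 - a * y) = 0 := by linear_combination -hy
      rw [this]; exact p.zero_mem
    rcases hprime.mem_or_mem hz with hz | hx
    · exact ha (hprime.mem_of_pow_mem n hz)
    · exact ha ((p.add_mem_iff_left (p.mul_mem_left b hx)).1 hmem)

/-- The lower elementary matrix `[[1, 0], [x, 1]]` in `SL(2, 𝓞)`. -/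
def lowerT (x : 𝓞 K) : Matrix.SpecialLinearGroup (Fin 2) (𝓞 K) :=
  ⟨!![1, 0; x, 1], by simp [Matrix.det_fin_two_of]⟩

variable {K}

theorem coe_T (x : 𝓞 K) : (T K x : Matrix (Fin 2) (Fin 2) (𝓞 K)) = !![1, x; 0, 1] := rfl

theorem coe_lowerT (x : 𝓞 K) :
    (lowerT K x : Matrix (Fin 2) (Fin 2) (𝓞 K)) = !![1, 0; x, 1] := rfl

theorem T_mul_T_neg (x : 𝓞 K) : T K x * T K (-x) = 1 := by
  ext i j
  fin_cases i <;> fin_cases j <;> simp [coe_T]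

theorem lowerT_mem {N : Subgroup (Matrix.SpecialLinearGroup (Fin 2) (𝓞 K))} [hN : N.Normal]
    {x : 𝓞 K} (hx : T K (-x) ∈ N) : lowerT K x ∈ N := by
  let S : Matrix.SpecialLinearGroup (Fin 2) (𝓞 K) :=
    ⟨!![0, -1; 1, 0], by simp [Matrix.det_fin_two_of]⟩
  have hS : (S : Matrix (Fin 2) (Fin 2) (𝓞 K)) = !![0, -1; 1, 0] := rfl
  have h : lowerT K x = S * T K (-x) * S⁻¹ := by
    rw [eq_mul_inv_iff_mul_eq]
    ext i j
    fin_cases i <;> fin_cases j <;> simp [coe_T, coe_lowerT, hS]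
  rw [h]
  exact hN.conj_mem _ hx S

theorem red_eq_red_iff {π : Ideal (𝓞 K)} {g h : Matrix.SpecialLinearGroup (Fin 2) (𝓞 K)} :
    red K π g = red K π h ↔ ∀ i j, g i j - h i j ∈ π := by
  simp [red, Matrix.SpecialLinearGroup.ext_iff, Ideal.Quotient.eq]

/-- Modulo `π`, a matrix in `SL(2, 𝓞)` with invertible upper left entry is determined by its other
three entries. -/
theorem red_eq_red_of_isUnit_mod {π : Ideal (𝓞 K)}
    {g h : Matrix.SpecialLinearGroup (Fin 2) (𝓞 K)} {v : 𝓞 K} (hv : g 0 0 * v - 1 ∈ π)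
    (h₀₀ : g 0 0 - h 0 0 ∈ π) (h₀₁ : g 0 1 - h 0 1 ∈ π) (h₁₀ : g 1 0 - h 1 0 ∈ π) :
    red K π g = red K π h := by
  have hg := g.det_coe
  have hh := h.det_coe
  rw [Matrix.det_fin_two] at hg hh
  have h₁₁ : g 1 1 - h 1 1 = -(g 1 1 - h 1 1) * (g 0 0 * v - 1) + v * g 1 0 * (g 0 1 - h 0 1)
      + v * h 0 1 * (g 1 0 - h 1 0) - v * h 1 1 * (g 0 0 - h 0 0) := by
    linear_combination v * hg - v * hh
  simp only [red_eq_red_iff, Fin.forall_fin_two]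
  refine ⟨⟨h₀₀, h₀₁⟩, h₁₀, ?_⟩
  rw [h₁₁]
  exact π.sub_mem (π.add_mem (π.add_mem (π.mul_mem_left _ hv) (π.mul_mem_left _ h₀₁))
    (π.mul_mem_left _ h₁₀)) (π.mul_mem_left _ h₀₀)

theorem mem_Gamma_iff {π : Ideal (𝓞 K)} {g : Matrix.SpecialLinearGroup (Fin 2) (𝓞 K)} :
    g ∈ Gamma K π ↔ g 0 0 - 1 ∈ π ∧ g 0 1 ∈ π ∧ g 1 0 ∈ π ∧ g 1 1 - 1 ∈ π := by
  rw [Gamma, MonoidHom.mem_ker, ← map_one (red K π), red_eq_red_iff]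
  simp [Fin.forall_fin_two, and_assoc]

theorem Gamma_anti {π ρ : Ideal (𝓞 K)} (h : π ≤ ρ) : Gamma K π ≤ Gamma K ρ := by
  intro g
  simp only [mem_Gamma_iff]
  exact fun ⟨h₁, h₂, h₃, h₄⟩ => ⟨h h₁, h h₂, h h₃, h h₄⟩

theorem T_mem_Gamma {π : Ideal (𝓞 K)} {x : 𝓞 K} (hx : x ∈ π) : T K x ∈ Gamma K π := by
  simp [mem_Gamma_iff, coe_T, hx]

theorem mem_of_red_eq {π : Ideal (𝓞 K)} {N : Subgroup (Matrix.SpecialLinearGroup (Fin 2) (𝓞 K))}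
    (hN : Gamma K π ≤ N) {g h : Matrix.SpecialLinearGroup (Fin 2) (𝓞 K)} (hh : h ∈ N)
    (hgh : red K π g = red K π h) : g ∈ N := by
  have : h⁻¹ * g ∈ N := hN <| by
    rw [Gamma, MonoidHom.mem_ker, map_mul, map_inv, hgh, inv_mul_cancel]
  simpa using N.mul_mem hh this

/-- An element of `Γ(m𝓞)` whose upper left entry is invertible modulo `π` is congruent modulo `π`
to a product of conjugates of the matrices `T_{mx}`. -/
theorem mem_of_isUnit_mod {π : Ideal (𝓞 K)} {m : 𝓞 K}
    {N : Subgroup (Matrix.SpecialLinearGroup (Fin 2) (𝓞 K))} [hN : N.Normal]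
    (hπ : Gamma K π ≤ N) (hT : ∀ x, T K (m * x) ∈ N)
    {g : Matrix.SpecialLinearGroup (Fin 2) (𝓞 K)} (hg : g ∈ Gamma K (Ideal.span {m}))
    {v : 𝓞 K} (hv : g 0 0 * v - 1 ∈ π) : g ∈ N := by
  have hL (x : 𝓞 K) : lowerT K (m * x) ∈ N := lowerT_mem <| by
    simpa using hT (-x)
  simp only [mem_Gamma_iff, Ideal.mem_span_singleton'] at hg
  obtain ⟨⟨y, hy⟩, ⟨b, hb⟩, ⟨c, hc⟩, -⟩ := hg
  have hconj : T K 1 * lowerT K (m * y) * T K (-1) ∈ N := by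
    have h := hN.conj_mem _ (hL y) (T K 1)
    rwa [inv_eq_of_mul_eq_one_right (T_mul_T_neg (1 : 𝓞 K))] at h
  refine mem_of_red_eq hπ
    (N.mul_mem (N.mul_mem (hL (v * (c - y))) hconj) (hT (v * (b + y)))) ?_
  have ha : g 0 0 = 1 + m * y := by linear_combination -hy
  refine red_eq_red_of_isUnit_mod hv ?_ ?_ ?_
  · convert π.zero_mem using 1
    simp [coe_T, coe_lowerT, ha]
  · convert π.mul_mem_left (-(m * (b + y))) hv using 1
    simp [coe_T, coe_lowerT, ha, ← hb]
    ring
  · convert π.mul_mem_left (-(m * (c - y))) hv using 1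
    simp [coe_T, coe_lowerT, ha, ← hc]
    ring

/-- A normal subgroup containing `Γ(π)` for some `π ≠ 0` and every `T_{mx}` contains `Γ(m𝓞)`. -/
theorem Gamma_span_singleton_le {π : Ideal (𝓞 K)} (hπ0 : π ≠ ⊥) {m : 𝓞 K}
    {N : Subgroup (Matrix.SpecialLinearGroup (Fin 2) (𝓞 K))} [hN : N.Normal]
    (hπ : Gamma K π ≤ N) (hT : ∀ x, T K (m * x) ∈ N) : Gamma K (Ideal.span {m}) ≤ N := by
  intro g hg
  have := Ideal.finiteQuotientOfFreeOfNeBot π hπ0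
  have hdet := g.det_coe
  rw [Matrix.det_fin_two] at hdet
  have hcop : IsCoprime (g 0 0) (g 0 1 * m) := by
    obtain ⟨y, hy⟩ := Ideal.mem_span_singleton'.1 (mem_Gamma_iff.1 hg).1
    exact .mul_right ⟨g 1 1, -g 1 0, by linear_combination hdet⟩
      ⟨1, -y, by linear_combination -hy⟩
  obtain ⟨x, hx⟩ := (hcop.map (Ideal.Quotient.mk π)).exists_isUnit_add_mul
  obtain ⟨x, rfl⟩ := Ideal.Quotient.mk_surjective x
  obtain ⟨v, hv⟩ := hx.exists_right_inv
  obtain ⟨v, rfl⟩ := Ideal.Quotient.mk_surjective v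
  have hL : lowerT K (m * x) ∈ N := lowerT_mem <| by simpa using hT (-x)
  have hLΓ : lowerT K (m * x) ∈ Gamma K (Ideal.span {m}) := by
    simp [mem_Gamma_iff, coe_lowerT, Ideal.mem_span_singleton]
  refine (N.mul_mem_cancel_right hL).1
    (mem_of_isUnit_mod hπ hT (mul_mem hg hLΓ) (v := v) ?_)
  rw [← Ideal.Quotient.eq, map_one, ← hv]
  simp [coe_lowerT, Matrix.mul_apply, Fin.sum_univ_two, mul_assoc]

/-- **Lemma 3.3.** For positive integers `m, n`, the normal closure in `Γ = SL(2,𝓞)` of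
`Γ((mn)𝓞) ∪ {T_{mx} : x ∈ 𝓞}` equals `Γ(m𝓞)`. -/
theorem normalClosure_Gamma (m n : ℕ) (hm : 0 < m) (hn : 0 < n) :
    Subgroup.normalClosure
        ((Gamma K (Ideal.span {((m * n : ℕ) : 𝓞 K)}) :
            Set (Matrix.SpecialLinearGroup (Fin 2) (𝓞 K))) ∪
          {x : Matrix.SpecialLinearGroup (Fin 2) (𝓞 K) |
            ∃ a : 𝓞 K, x = T K ((m : 𝓞 K) * a)}) =
      Gamma K (Ideal.span {((m : ℕ) : 𝓞 K)}) := by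
  have hsub := Subgroup.subset_normalClosure
    (s := (Gamma K (Ideal.span {((m * n : ℕ) : 𝓞 K)}) :
            Set (Matrix.SpecialLinearGroup (Fin 2) (𝓞 K))) ∪
          {x : Matrix.SpecialLinearGroup (Fin 2) (𝓞 K) |
            ∃ a : 𝓞 K, x = T K ((m : 𝓞 K) * a)})
  apply le_antisymm
  · have : (Gamma K (Ideal.span {(m : 𝓞 K)})).Normal := MonoidHom.normal_ker _
    refine Subgroup.normalClosure_le_normal (Set.union_subset (Gamma_anti ?_) ?_)
    · rw [Ideal.span_singleton_le_span_singleton]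
      exact ⟨n, by push_cast; rfl⟩
    · rintro _ ⟨a, rfl⟩
      exact T_mem_Gamma (Ideal.mem_span_singleton.2 (dvd_mul_right _ _))
  · refine Gamma_span_singleton_le (π := Ideal.span {((m * n : ℕ) : 𝓞 K)}) ?_
      (fun g hg => hsub (.inl hg)) (fun x => hsub (.inr ⟨x, rfl⟩))
    rw [Ne, Ideal.span_singleton_eq_bot, Nat.cast_eq_zero]
    exact (Nat.mul_pos hm hn).ne'
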